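/- arXiv:2011.08897 — 10 statements merged into one kernel-verified Lean document; each statement's English description precedes it below -/
import Mathlib

section
/- Let L be a frame and {S_i}_{i∈I} any family of D-sublocales of L. Then the join ⋁_i S_i, computed in the coframe S(L) of all sublocales of L, is again a D-sublocale of L. Hence S_D(L) is closed under arbitrary joins in S(L). -/
open Set

universe u

namespace TD

variable {L : Type u} [Order.Frame L]

/-- A sublocale of a frame `L`: a subset closed under arbitrary meets and
under `a ⇨ -` for every `a : L`. -/
def IsSublocale (S : Set L) : Prop :=
  (∀ A : Set L, A ⊆ S → sInf A ∈ S) ∧ ∀ a : L, ∀ s ∈ S, (a ⇨ s) ∈ S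

/-- The covered primes of the (sub)frame `S` (meets computed in `L`,
which agree with meets in `S` when `S` is a sublocale).  The covered primes
of `L` itself are `ptD (Set.univ)`. -/
def ptD (S : Set L) : Set L :=
  {p | p ∈ S ∧ p ≠ ⊤ ∧ ∀ A : Set L, A ⊆ S → sInf A = p → p ∈ A}

/-- The primes of the (sub)frame `S`.  The primes of `L` itself are
`pt (Set.univ)`. -/
def pt (S : Set L) : Set L :=
  {p | p ∈ S ∧ p ≠ ⊤ ∧ ∀ x ∈ S, ∀ y ∈ S, p = x ⊓ y → p = x ∨ p = y}

/-- A D-sublocale: a sublocale all of whose covered primes are covered primes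
of the ambient frame `L`. -/
def IsDSublocale (S : Set L) : Prop :=
  IsSublocale S ∧ ptD S ⊆ ptD (univ : Set L)

/-- The join, computed in the coframe `S(L)` of all sublocales, of a family of
subsets of `L`: all meets of subsets of the union. -/
def sJoin (𝒮 : Set (Set L)) : Set L :=
  {x | ∃ A : Set L, A ⊆ ⋃₀ 𝒮 ∧ sInf A = x}

/-- Binary join in `S(L)`. -/
def join2 (S T : Set L) : Set L := sJoin {S, T}

/-- The closed sublocale `c(a) = ↑a`. -/
def closedSub (a : L) : Set L := Ici a

/-- The open sublocale `o(a) = {a ⇨ b | b ∈ L}`. -/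
def openSub (a : L) : Set L := {x | ∃ b : L, x = a ⇨ b}

/-- The Boolean sublocale `b(a) = {x ⇨ a | x ∈ L}`. -/
def bSub (a : L) : Set L := {x | ∃ y : L, x = y ⇨ a}

/-- A complemented sublocale: one having a complement in the coframe `S(L)`
(whose bottom is `{⊤}` and top is `L` itself, i.e. `Set.univ`). -/
def IsComplementedSublocale (C : Set L) : Prop :=
  IsSublocale C ∧ ∃ C' : Set L, IsSublocale C' ∧ C ∩ C' = {⊤} ∧ join2 C C' = univ

/-- A smooth sublocale: a join in `S(L)` of complemented sublocales. -/
def IsSmooth (S : Set L) : Prop :=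
  ∃ 𝒞 : Set (Set L), (∀ C ∈ 𝒞, IsComplementedSublocale C) ∧ S = sJoin 𝒞

/-- `M Y`: the closure of `Y` under arbitrary meets (with `⋀ ∅ = ⊤`). -/
def M (Y : Set L) : Set L := {x | ∃ A : Set L, A ⊆ Y ∧ sInf A = x}

/-- The (sub)frame `S` is `T_D`-spatial: every element of `S` is a meet of
covered primes of `S`. -/
def IsTDSpatialSub (S : Set L) : Prop :=
  ∀ s ∈ S, ∃ P : Set L, P ⊆ ptD S ∧ sInf P = s

/-- The (sub)frame `S` is spatial: every element of `S` is a meet of primes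
of `S`. -/
def IsSpatialSub (S : Set L) : Prop :=
  ∀ s ∈ S, ∃ P : Set L, P ⊆ pt S ∧ sInf P = s

/-- The primes of `L` lying above `a`, i.e. `pt(↑a)`. -/
def ptAbove (a : L) : Set L := {p | p ∈ pt (univ : Set L) ∧ a ≤ p}

/-- A prime of the frame `S_D(L)^op` (order-reversed coframe of D-sublocales):
a D-sublocale `P ≠ {⊤}` such that `P = S₁ ∨ S₂` (join in `S(L)`) with
`S₁, S₂` D-sublocales implies `P = S₁` or `P = S₂`. -/
def PrimeInSDop (P : Set L) : Prop :=
  IsDSublocale P ∧ P ≠ ({⊤} : Set L) ∧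
    ∀ S₁ S₂ : Set L, IsDSublocale S₁ → IsDSublocale S₂ →
      P = join2 S₁ S₂ → P = S₁ ∨ P = S₂

/-- A covered prime of the frame `S_D(L)^op`: a D-sublocale `P ≠ {⊤}` such
that whenever `P` is a join of a family of D-sublocales, it equals one of
them. -/
def CovPrimeInSDop (P : Set L) : Prop :=
  IsDSublocale P ∧ P ≠ ({⊤} : Set L) ∧
    ∀ 𝒮 : Set (Set L), (∀ T ∈ 𝒮, IsDSublocale T) → P = sJoin 𝒮 → ∃ T ∈ 𝒮, P = T

/-- A prime of the frame `S(L)^op`. -/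
def PrimeInSop (P : Set L) : Prop :=
  IsSublocale P ∧ P ≠ ({⊤} : Set L) ∧
    ∀ S₁ S₂ : Set L, IsSublocale S₁ → IsSublocale S₂ →
      P = join2 S₁ S₂ → P = S₁ ∨ P = S₂

/-- A prime of the frame `S_b(L)^op` of smooth sublocales. -/
def PrimeInSbop (P : Set L) : Prop :=
  IsSmooth P ∧ P ≠ ({⊤} : Set L) ∧
    ∀ S₁ S₂ : Set L, IsSmooth S₁ → IsSmooth S₂ →
      P = join2 S₁ S₂ → P = S₁ ∨ P = S₂

/-- A prime element of a complete lattice. -/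
def IsPrimeElt {α : Type*} [CompleteLattice α] (p : α) : Prop :=
  p ≠ ⊤ ∧ ∀ x y : α, p = x ⊓ y → p = x ∨ p = y

/-- A `T_D` topological space: `T₀` and every point has an open
neighbourhood `U` with `U \ {x}` open. -/
def IsTDSpace (X : Type*) [TopologicalSpace X] : Prop :=
  T0Space X ∧ ∀ x : X, ∃ U : Set X, IsOpen U ∧ x ∈ U ∧ IsOpen (U \ {x})

/-- A sober space: every prime of the frame of opens is of the form
`X ∖ cl {x}` for a unique point `x`. -/
def IsSoberSpace (X : Type*) [TopologicalSpace X] : Prop :=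
  ∀ p : TopologicalSpace.Opens X, IsPrimeElt p →
    ∃! x : X, p = ⟨(closure {x})ᶜ, isClosed_closure.isOpen_compl⟩


theorem subset_sJoin {𝒮 : Set (Set L)} {S : Set L} (hS : S ∈ 𝒮) : S ⊆ sJoin 𝒮 :=
  fun x hx => ⟨{x}, by rintro _ rfl; exact ⟨S, hS, hx⟩, sInf_singleton⟩

theorem sUnion_subset_sJoin (𝒮 : Set (Set L)) : ⋃₀ 𝒮 ⊆ sJoin 𝒮 :=
  sUnion_subset fun _ => subset_sJoin

theorem ptD_inter_subset {S T : Set L} (h : S ⊆ T) : ptD T ∩ S ⊆ ptD S :=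
  fun _ hp => ⟨hp.2, hp.1.2.1, fun A hA => hp.1.2.2 A (hA.trans h)⟩

theorem sInf_mem_sJoin {𝒮 : Set (Set L)} {B : Set L} (hB : B ⊆ sJoin 𝒮) :
    sInf B ∈ sJoin 𝒮 := by
  refine ⟨{u | u ∈ ⋃₀ 𝒮 ∧ ∃ b ∈ B, b ≤ u}, fun u hu => hu.1, le_antisymm ?_ ?_⟩
  · refine le_sInf fun b hb => ?_
    obtain ⟨A, hA, rfl⟩ := hB hb
    exact le_sInf fun u hu => sInf_le ⟨hA hu, _, hb, sInf_le hu⟩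
  · refine le_sInf ?_
    rintro u ⟨-, b, hb, hbu⟩
    exact (sInf_le hb).trans hbu

theorem isSublocale_sJoin {𝒮 : Set (Set L)} (h𝒮 : ∀ S ∈ 𝒮, IsSublocale S) :
    IsSublocale (sJoin 𝒮) := by
  refine ⟨fun _ => sInf_mem_sJoin, ?_⟩
  rintro a _ ⟨A, hA, rfl⟩
  have himage : a ⇨ sInf A = sInf ((a ⇨ ·) '' A) := by
    rw [sInf_image]
    refine eq_of_forall_le_iff fun c => ?_
    simp [le_himp_iff]
  rw [himage]
  refine sInf_mem_sJoin ?_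
  rintro _ ⟨x, hx, rfl⟩
  obtain ⟨S, hS, hxS⟩ := hA hx
  exact subset_sJoin hS ((h𝒮 S hS).2 a x hxS)

/-- the join in `S(L)` of any family of D-sublocales is a
D-sublocale; hence `S_D(L)` is closed under arbitrary joins in `S(L)`. -/
theorem join_isDSublocale {ι : Type*} (S : ι → Set L)
    (hS : ∀ i, IsDSublocale (S i)) :
    IsDSublocale (sJoin (Set.range S)) := by
  refine ⟨isSublocale_sJoin (forall_mem_range.2 fun i => (hS i).1), fun p hp => ?_⟩
  obtain ⟨A, hA, hAp⟩ := hp.1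
  obtain ⟨_, ⟨i, rfl⟩, hpi⟩ := hA (hp.2.2 A (hA.trans (sUnion_subset_sJoin _)) hAp)
  exact (hS i).2 (ptD_inter_subset (subset_sJoin (mem_range_self i)) ⟨hp, hpi⟩)

end TD
end

section
/- Let L be a frame. Every smooth sublocale of L (every join in S(L) of complemented sublocales) is a D-sublocale of L; in particular every open sublocale o(a) and every closed sublocale c(a) of L is a D-sublocale. Consequently S_b(L) ⊆ S_D(L). -/
open Set

universe u

namespace TD

variable {L : Type u} [Order.Frame L]

theorem IsSublocale.eq_or_eq_of_mem_ptD {S : Set L} (hS : IsSublocale S) {p c d : L}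
    (hp : p ∈ ptD S) (h : c ⊓ d = p) : c = p ∨ d = p := by
  obtain ⟨hpS, -, hcov⟩ := hp
  have hc : p ≤ c := h ▸ inf_le_left
  have hd : p ≤ d := h ▸ inf_le_right
  have hmem := hcov {d ⇨ p, (d ⇨ p) ⇨ p}
    (by
      rintro x (rfl | rfl)
      · exact hS.2 _ _ hpS
      · exact hS.2 _ _ hpS)
    (by
      rw [sInf_pair]
      exact le_antisymm inf_himp_le (le_inf le_himp le_himp))
  rcases hmem with h' | h'
  · left
    refine le_antisymm ?_ hc
    rw [h', le_himp_iff]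
    exact h.le
  · right
    refine le_antisymm ?_ hd
    have h' : p = (d ⇨ p) ⇨ p := h'
    rw [h', le_himp_iff]
    exact inf_himp_le

theorem IsComplementedSublocale.isDSublocale {C : Set L} (hC : IsComplementedSublocale C) :
    IsDSublocale C := by
  obtain ⟨hC, C', hC', hinter, hjoin⟩ := hC
  refine ⟨hC, fun p hp => ⟨mem_univ p, hp.2.1, fun A _ hA => ?_⟩⟩
  have hmem (T : Set L) (hT : IsSublocale T) : sInf {y ∈ T | ∃ x ∈ A, x ≤ y} ∈ T :=
    hT.1 _ fun y hy => hy.1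
  have hle (T : Set L) : p ≤ sInf {y ∈ T | ∃ x ∈ A, x ≤ y} := by
    refine le_sInf ?_
    rintro y ⟨-, x, hx, hxy⟩
    exact (hA ▸ sInf_le hx : p ≤ x).trans hxy
  have hmeet : sInf {y ∈ C | ∃ x ∈ A, x ≤ y} ⊓ sInf {y ∈ C' | ∃ x ∈ A, x ≤ y} = p := by
    refine le_antisymm ?_ (le_inf (hle C) (hle C'))
    conv_rhs => rw [← hA]
    refine le_sInf fun x hx => ?_
    obtain ⟨E, hE, rfl⟩ : x ∈ join2 C C' := hjoin ▸ mem_univ x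
    refine le_sInf fun e he => ?_
    have hxe := sInf_le he
    obtain ⟨T, rfl | rfl, heT⟩ := hE he
    · exact inf_le_left.trans (sInf_le ⟨heT, _, hx, hxe⟩)
    · exact inf_le_right.trans (sInf_le ⟨heT, _, hx, hxe⟩)
  rcases hC.eq_or_eq_of_mem_ptD hp hmeet with h | h
  · obtain ⟨-, x, hx, hxp⟩ := hp.2.2 _ (fun y hy => hy.1) h
    rwa [le_antisymm (hA ▸ sInf_le hx) hxp]
  · have hpC' : p ∈ C' := by simpa only [h] using hmem C' hC'
    exact absurd (hinter ▸ ⟨hp.1, hpC'⟩ : p ∈ ({⊤} : Set L)) hp.2.1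

theorem isDSublocale_sJoin {𝒮 : Set (Set L)} (h𝒮 : ∀ S ∈ 𝒮, IsDSublocale S) :
    IsDSublocale (sJoin 𝒮) := by
  refine ⟨isSublocale_sJoin fun S hS => (h𝒮 S hS).1, ?_⟩
  rintro p ⟨⟨A, hA, hAp⟩, hp, hcov⟩
  obtain ⟨S, hS, hpS⟩ := hA (hcov A (fun x hx =>
    let ⟨_, hS, hxS⟩ := hA hx
    subset_sJoin hS hxS) hAp)
  exact (h𝒮 S hS).2 ⟨hpS, hp, fun B hB => hcov B (hB.trans (subset_sJoin hS))⟩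

theorem isSublocale_closedSub (a : L) : IsSublocale (closedSub a) :=
  ⟨fun _ hA => le_sInf hA, fun _ _ hs => le_trans hs le_himp⟩

theorem mem_openSub_iff {a x : L} : x ∈ openSub a ↔ a ⇨ x = x := by
  constructor
  · rintro ⟨b, rfl⟩
    exact himp_idem
  · exact fun h => ⟨x, h.symm⟩

theorem isSublocale_openSub (a : L) : IsSublocale (openSub a) := by
  constructor
  · intro A hA
    rw [mem_openSub_iff, sInf_eq_iInf]
    simp only [himp_iInf_eq]
    exact iInf_congr fun x => iInf_congr fun hx => mem_openSub_iff.1 (hA hx)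
  · rintro b _ ⟨c, rfl⟩
    exact ⟨b ⇨ c, himp_left_comm b a c⟩

theorem isComplementedSublocale_openSub (a : L) : IsComplementedSublocale (openSub a) := by
  refine ⟨isSublocale_openSub a, closedSub a, isSublocale_closedSub a, ?_, ?_⟩
  · ext x
    simp only [mem_inter_iff, mem_openSub_iff, mem_singleton_iff]
    constructor
    · rintro ⟨h, hax⟩
      rw [← h]
      exact himp_eq_top_iff.2 hax
    · rintro rfl
      exact ⟨himp_top, le_top (a := a)⟩
  · refine eq_univ_of_forall fun x => ⟨{a ⇨ x, a ⊔ x}, ?_, ?_⟩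
    · rintro y (rfl | rfl)
      · exact ⟨openSub a, Or.inl rfl, x, rfl⟩
      · exact ⟨closedSub a, Or.inr rfl, le_sup_left (a := a)⟩
    · rw [sInf_pair, inf_sup_left, himp_inf_self, inf_eq_right.2 le_himp]
      exact sup_eq_right.2 inf_le_left

theorem isDSublocale_closedSub (a : L) : IsDSublocale (closedSub a) :=
  ⟨isSublocale_closedSub a, fun _ hp => ⟨mem_univ _, hp.2.1, fun A _ hA =>
    hp.2.2 A (fun _ hx => le_trans hp.1 (hA ▸ sInf_le hx)) hA⟩⟩

/-- every smooth sublocale is a D-sublocale; in particular every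
open and every closed sublocale is a D-sublocale.  Consequently
`S_b(L) ⊆ S_D(L)`. -/
theorem smooth_isDSublocale (L : Type u) [Order.Frame L] :
    (∀ S : Set L, IsSmooth S → IsDSublocale S) ∧
    (∀ a : L, IsDSublocale (openSub a) ∧ IsDSublocale (closedSub a)) := by
  refine ⟨?_, fun a =>
    ⟨(isComplementedSublocale_openSub a).isDSublocale, isDSublocale_closedSub a⟩⟩
  rintro _ ⟨𝒞, h𝒞, rfl⟩
  exact isDSublocale_sJoin fun C hC => (h𝒞 C hC).isDSublocale

end TD
end

section
/- Let L be a frame. For every subset Y ⊆ pt_D(L), the set M(Y) is a D-sublocale of L, and the maps M : P(pt_D(L)) → S_D(L) and pt_D : S_D(L) → P(pt_D(L)) form a Galois adjunction between the powerset of pt_D(L) ordered by inclusion and S_D(L) ordered by inclusion: M(Y) ⊆ S if and only if Y ⊆ pt_D(S), for every Y ⊆ pt_D(L) and every D-sublocale S of L. Moreover the composite pt_D ∘ M is the identity: pt_D(M(Y)) = Y for every Y ⊆ pt_D(L). -/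
open Set

universe u

namespace TD

variable {L : Type u} [Order.Frame L]

theorem himp_eq_self_of_mem_ptD {p a : L} (hp : p ∈ ptD (univ : Set L)) (ha : ¬ a ≤ p) :
    a ⇨ p = p := by
  have h : sInf {a ⊔ p, a ⇨ p} = p := by
    rw [sInf_pair]
    refine le_antisymm ?_ (le_inf le_sup_right le_himp)
    rw [inf_sup_right]
    exact sup_le inf_himp_le inf_le_left
  rcases hp.2.2 _ (subset_univ _) h with h | h
  · exact absurd (sup_eq_right.mp h.symm) ha
  · exact h.symm

theorem subset_M (Y : Set L) : Y ⊆ M Y := fun p hp =>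
  ⟨{p}, singleton_subset_iff.mpr hp, sInf_singleton⟩

theorem sInf_mem_M {Y A : Set L} (hA : A ⊆ M Y) : sInf A ∈ M Y := by
  refine ⟨{y ∈ Y | sInf A ≤ y}, fun y hy => hy.1, le_antisymm ?_ (le_sInf fun y hy => hy.2)⟩
  refine le_sInf fun x hx => ?_
  obtain ⟨B, hB, rfl⟩ := hA hx
  exact le_sInf fun y hy => sInf_le ⟨hB hy, (sInf_le hx).trans (sInf_le hy)⟩

theorem himp_mem_M {Y : Set L} (hY : Y ⊆ ptD (univ : Set L)) (a : L) {s : L} (hs : s ∈ M Y) :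
    a ⇨ s ∈ M Y := by
  obtain ⟨A, hA, rfl⟩ := hs
  refine ⟨{p ∈ A | ¬ a ≤ p}, fun p hp => hA hp.1, le_antisymm ?_ ?_⟩
  · rw [le_himp_iff]
    refine le_sInf fun p hp => ?_
    by_cases h : a ≤ p
    · exact inf_le_right.trans h
    · exact inf_le_left.trans (sInf_le ⟨hp, h⟩)
  · refine le_sInf fun p hp => ?_
    exact (himp_le_himp_left (sInf_le hp.1)).trans
      (himp_eq_self_of_mem_ptD (hY (hA hp.1)) hp.2).le

theorem isSublocale_M {Y : Set L} (hY : Y ⊆ ptD (univ : Set L)) : IsSublocale (M Y) :=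
  ⟨fun _ => sInf_mem_M, fun a _ => himp_mem_M hY a⟩

theorem mem_ptD_of_subset {S T : Set L} (h : S ⊆ T) {p : L} (hp : p ∈ ptD T) (hpS : p ∈ S) :
    p ∈ ptD S :=
  ⟨hpS, hp.2.1, fun A hA => hp.2.2 A (hA.trans h)⟩

theorem ptD_M_eq {Y : Set L} (hY : Y ⊆ ptD (univ : Set L)) : ptD (M Y) = Y := by
  refine Subset.antisymm (fun p hp => ?_) fun p hp =>
    mem_ptD_of_subset (subset_univ _) (hY hp) (subset_M Y hp)
  obtain ⟨A, hA, hAp⟩ := hp.1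
  exact hA (hp.2.2 A (hA.trans (subset_M Y)) hAp)

theorem M_subset_iff {Y S : Set L} (hY : Y ⊆ ptD (univ : Set L)) (hS : IsSublocale S) :
    M Y ⊆ S ↔ Y ⊆ ptD S := by
  refine ⟨fun h p hp => mem_ptD_of_subset (subset_univ _) (hY hp) (h (subset_M Y hp)), ?_⟩
  rintro h _ ⟨A, hA, rfl⟩
  exact hS.1 A fun p hp => (h (hA hp)).1

/-- for every `Y ⊆ pt_D(L)`, `M(Y)` is a D-sublocale, the maps
`M` and `pt_D` form a Galois adjunction (`M(Y) ⊆ S ↔ Y ⊆ pt_D(S)`), and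
`pt_D ∘ M` is the identity. -/
theorem M_ptD_adjunction (L : Type u) [Order.Frame L] :
    (∀ Y : Set L, Y ⊆ ptD (univ : Set L) → IsDSublocale (M Y)) ∧
    (∀ Y : Set L, Y ⊆ ptD (univ : Set L) →
      ∀ S : Set L, IsDSublocale S → (M Y ⊆ S ↔ Y ⊆ ptD S)) ∧
    (∀ Y : Set L, Y ⊆ ptD (univ : Set L) → ptD (M Y) = Y) := by
  exact ⟨fun Y hY => ⟨isSublocale_M hY, (ptD_M_eq hY).trans_subset hY⟩,
    fun Y hY S hS => M_subset_iff hY hS.1, fun Y hY => ptD_M_eq hY⟩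

end TD
end

section
/- Let L be a frame. The sublocale M(pt_D(L)) is a T_D-spatial D-sublocale of L, and every T_D-spatial D-sublocale S of L satisfies S ⊆ M(pt_D(L)). In other words, M(pt_D(L)) is the largest T_D-spatial D-sublocale of L (the T_D-spatialization sublocale of L). -/
open Set

universe u

namespace TD

variable {L : Type u} [Order.Frame L]

theorem M_mono {Y Z : Set L} (h : Y ⊆ Z) : M Y ⊆ M Z :=
  fun _ ⟨A, hA, hx⟩ => ⟨A, hA.trans h, hx⟩

theorem himp_mem_M_ptD (a : L) {s : L} (hs : s ∈ M (ptD (univ : Set L))) :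
    a ⇨ s ∈ M (ptD (univ : Set L)) := by
  obtain ⟨A, hA, rfl⟩ := hs
  refine ⟨{p ∈ A | ¬ a ≤ p}, fun p hp => hA hp.1, le_antisymm ?_ (le_sInf fun p hp => ?_)⟩
  · rw [le_himp_iff]
    refine le_sInf fun p hp => ?_
    by_cases h : a ≤ p
    · exact inf_le_right.trans h
    · exact inf_le_left.trans (sInf_le ⟨hp, h⟩)
  · rw [← himp_eq_self_of_mem_ptD (hA hp.1) hp.2]
    exact himp_le_himp_left (sInf_le hp.1)

theorem isSublocale_M_ptD : IsSublocale (M (ptD (univ : Set L))) :=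
  ⟨fun _ hA => sInf_mem_M hA, fun a _ hs => himp_mem_M_ptD a hs⟩

theorem ptD_M_subset (Y : Set L) : ptD (M Y) ⊆ Y := by
  rintro p ⟨⟨A, hA, hp⟩, -, hcov⟩
  exact hA (hcov A (hA.trans (subset_M Y)) hp)

theorem ptD_univ_subset_ptD_M : ptD (univ : Set L) ⊆ ptD (M (ptD (univ : Set L))) :=
  fun _ hp => ⟨subset_M _ hp, hp.2.1, fun A _ => hp.2.2 A (subset_univ A)⟩

/-- `M(pt_D(L))` is a `T_D`-spatial D-sublocale of `L`, and it is
the largest such: every `T_D`-spatial D-sublocale is contained in it. -/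
theorem M_ptD_largest_TD_spatial (L : Type u) [Order.Frame L] :
    IsDSublocale (M (ptD (univ : Set L))) ∧
    IsTDSpatialSub (M (ptD (univ : Set L))) ∧
    ∀ S : Set L, IsDSublocale S → IsTDSpatialSub S →
      S ⊆ M (ptD (univ : Set L)) := by
  refine ⟨⟨isSublocale_M_ptD, ptD_M_subset _⟩, M_mono ptD_univ_subset_ptD_M, ?_⟩
  intro S hS hspat s hs
  exact M_mono hS.2 (hspat s hs)

end TD
end

section
/- Let L be a frame and S a D-sublocale of L. Then S is T_D-spatial if and only if S = ⋁{ b(p) : p ∈ pt_D(S) }, where b(p) = {1, p} and the join is computed in the coframe S(L) of sublocales of L. -/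
open Set

universe u

namespace TD

variable {L : Type u} [Order.Frame L]

theorem sJoin_points_eq_M (Y : Set L) :
    sJoin ((fun p => ({⊤, p} : Set L)) '' Y) = M Y := by
  ext x
  constructor
  · rintro ⟨A, hA, rfl⟩
    refine ⟨A \ {⊤}, fun a ha => ?_, sInf_sdiff_singleton_top A⟩
    obtain ⟨_, ⟨p, hp, rfl⟩, rfl | rfl⟩ := hA ha.1
    · exact absurd rfl ha.2
    · exact hp
  · rintro ⟨A, hA, rfl⟩
    exact ⟨A, fun a ha => ⟨_, mem_image_of_mem _ (hA ha), Or.inr rfl⟩, rfl⟩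

theorem IsSublocale.M_subset {S Y : Set L} (hS : IsSublocale S) (hY : Y ⊆ S) : M Y ⊆ S := by
  rintro _ ⟨A, hA, rfl⟩
  exact hS.1 A (hA.trans hY)

/-- a D-sublocale `S` is `T_D`-spatial iff it is the join in
`S(L)` of the sublocales `b(p) = {⊤, p}` for `p ∈ pt_D(S)`. -/
theorem tdSpatial_iff_join_of_points (S : Set L) (hS : IsDSublocale S) :
    IsTDSpatialSub S ↔
      S = sJoin ((fun p => ({⊤, p} : Set L)) '' ptD S) := by
  rw [sJoin_points_eq_M]
  exact ⟨fun h => Subset.antisymm h (hS.1.M_subset fun _ hp => hp.1), fun h => h.subset⟩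

end TD
end

section
/- A frame L is isomorphic (as a frame) to the lattice of open sets of some T_D topological space if and only if every element of L is a meet of covered primes of L. -/
open Set

universe u

namespace TD

variable {L : Type u} [Order.Frame L]

open TopologicalSpace

/-- The open set of covered primes not above `a`. -/
def covOpen {L : Type u} [Order.Frame L] (a : L) : Set (ptD (univ : Set L)) :=
  {p | ¬ a ≤ p.1}

theorem inf_le_of_mem_ptD {L : Type u} [Order.Frame L] {p : L}
    (hp : p ∈ ptD (univ : Set L)) {a b : L} : a ⊓ b ≤ p ↔ a ≤ p ∨ b ≤ p := by
  refine ⟨fun h => ?_, fun h => h.elim inf_le_of_left_le inf_le_of_right_le⟩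
  have key : sInf {a ⊔ p, b ⊔ p} = p := by
    rw [sInf_pair, ← sup_inf_right, sup_eq_right]
    exact h
  rcases hp.2.2 _ (subset_univ _) key with h' | h'
  · exact Or.inl (sup_eq_right.1 h'.symm)
  · exact Or.inr (sup_eq_right.1 (mem_singleton_iff.1 h').symm)

theorem covOpen_sSup {L : Type u} [Order.Frame L] (A : Set L) :
    covOpen (sSup A) = ⋃ a ∈ A, covOpen a := by
  ext p
  simp [covOpen]

/-- The space of covered primes of a frame. -/
abbrev covTopology (L : Type u) [Order.Frame L] : TopologicalSpace (ptD (univ : Set L)) where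
  IsOpen U := ∃ a : L, covOpen a = U
  isOpen_univ := ⟨⊤, by
    ext p
    simpa [covOpen] using p.2.2.1⟩
  isOpen_inter := by
    rintro _ _ ⟨a, rfl⟩ ⟨b, rfl⟩
    refine ⟨a ⊓ b, ?_⟩
    ext p
    simp [covOpen, inf_le_of_mem_ptD p.2]
  isOpen_sUnion S hS := by
    refine ⟨sSup {a | covOpen a ∈ S}, ?_⟩
    rw [covOpen_sSup]
    ext p
    simp only [mem_iUnion, mem_sUnion, mem_ofPred_eq, exists_prop]
    constructor
    · rintro ⟨a, ha, hp⟩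
      exact ⟨_, ha, hp⟩
    · rintro ⟨U, hU, hp⟩
      obtain ⟨a, rfl⟩ := hS U hU
      exact ⟨a, hU, hp⟩

theorem isTDSpace_covTopology (L : Type u) [Order.Frame L] :
    @IsTDSpace (ptD (univ : Set L)) (covTopology L) := by
  let _ := covTopology L
  refine ⟨⟨fun p q h => ?_⟩, fun p => ?_⟩
  · have h' (a : L) : a ≤ p.1 ↔ a ≤ q.1 :=
      not_iff_not.1 (h.mem_open_iff (s := covOpen a) ⟨a, rfl⟩)
    exact Subtype.ext (le_antisymm ((h' _).1 le_rfl) ((h' _).2 le_rfl))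
  · have hle : p.1 ≤ sInf (Ioi p.1) := le_sInf fun _ hx => le_of_lt hx
    have hnot : ¬ sInf (Ioi p.1) ≤ p.1 := fun h =>
      lt_irrefl p.1 (p.2.2.2 _ (subset_univ _) (le_antisymm h hle))
    refine ⟨covOpen (sInf (Ioi p.1)), ⟨_, rfl⟩, hnot, p.1, ?_⟩
    ext q
    refine ⟨fun h => ⟨fun h' => h (hle.trans h'), ?_⟩, fun h hpq => ?_⟩
    · rintro rfl
      exact h le_rfl
    · exact h.1 (sInf_le (lt_of_le_of_ne hpq fun e => h.2 (Subtype.ext e.symm)))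

theorem covOpen_subset_iff {L : Type u} [Order.Frame L]
    (h : ∀ a : L, ∃ P : Set L, P ⊆ ptD (univ : Set L) ∧ sInf P = a) {a b : L} :
    covOpen a ⊆ covOpen b ↔ a ≤ b := by
  refine ⟨fun hab => ?_, fun hab p hp hb => hp (hab.trans hb)⟩
  obtain ⟨P, hP, rfl⟩ := h b
  refine le_sInf fun p hp => ?_
  by_contra hap
  exact @hab ⟨p, hP hp⟩ hap (sInf_le hp)

/-- The open complement of the closure of a point. -/
def coPoint {X : Type*} [TopologicalSpace X] (x : X) : Opens X :=
  ⟨(closure {x})ᶜ, isClosed_closure.isOpen_compl⟩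

theorem le_coPoint_iff {X : Type*} [TopologicalSpace X] {x : X} {V : Opens X} :
    V ≤ coPoint x ↔ x ∉ V := by
  change (V : Set X) ⊆ (closure {x})ᶜ ↔ x ∉ V
  rw [subset_compl_comm, V.isOpen.isClosed_compl.closure_subset_iff]
  simp

theorem mem_of_sInf_eq_coPoint {X : Type*} [TopologicalSpace X] {x : X} {U : Set X}
    (hU : IsOpen U) (hxU : x ∈ U) (hUx : IsOpen (U \ {x})) {A : Set (Opens X)}
    (hA : sInf A = coPoint x) : coPoint x ∈ A := by
  by_contra hmem
  have hdiff : (⟨U \ {x}, hUx⟩ : Opens X) ≤ coPoint x :=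
    le_coPoint_iff.2 fun h => h.2 rfl
  have hlower : (⟨U, hU⟩ : Opens X) ≤ sInf A := by
    refine le_sInf fun V hV => ?_
    have hle : coPoint x ≤ V := hA ▸ sInf_le hV
    have hxV : x ∈ V := by
      by_contra hx
      exact hmem (le_antisymm hle (le_coPoint_iff.2 hx) ▸ hV)
    intro y hy
    by_cases hyx : y = x
    · exact hyx ▸ hxV
    · exact hle (hdiff ⟨hy, hyx⟩)
  exact le_coPoint_iff.1 (hlower.trans hA.le) hxU

theorem sInf_coPoint {X : Type*} [TopologicalSpace X] (V : Opens X) :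
    sInf (coPoint '' {x | x ∉ V}) = V := by
  refine le_antisymm (fun x hx => ?_) (le_sInf ?_)
  · by_contra hxV
    exact le_coPoint_iff.1 (sInf_le (mem_image_of_mem coPoint hxV)) hx
  · rintro _ ⟨x, hx, rfl⟩
    exact le_coPoint_iff.2 hx

theorem symm_coPoint_mem_ptD {L : Type u} [Order.Frame L] {X : Type*} [TopologicalSpace X]
    (hX : IsTDSpace X) (e : L ≃o Opens X) (x : X) :
    e.symm (coPoint x) ∈ ptD (univ : Set L) := by
  obtain ⟨U, hU, hxU, hUx⟩ := hX.2 x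
  refine ⟨mem_univ _, fun h => ?_, fun A _ hA => ?_⟩
  · have : coPoint x = ⊤ := by simpa using h
    exact le_coPoint_iff.1 this.ge (Opens.mem_top x)
  · have hA' : sInf (e '' A) = coPoint x := by
      rw [sInf_image, ← e.map_sInf, hA, e.apply_symm_apply]
    obtain ⟨a, ha, hae⟩ := mem_of_sInf_eq_coPoint hU hxU hUx hA'
    rwa [← hae, e.symm_apply_apply]

/-- a frame is isomorphic to the frame of opens of some `T_D`
space iff every element of it is a meet of covered primes. -/
theorem td_spatial_iff (L : Type u) [Order.Frame L] :
    (∃ (X : Type u) (_ : TopologicalSpace X), IsTDSpace X ∧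
      Nonempty (L ≃o TopologicalSpace.Opens X)) ↔
    ∀ a : L, ∃ P : Set L, P ⊆ ptD (univ : Set L) ∧ sInf P = a := by
  constructor
  · rintro ⟨X, _, hX, ⟨e⟩⟩ a
    refine ⟨e.symm '' (coPoint '' {x | x ∉ e a}), ?_, ?_⟩
    · rintro _ ⟨_, ⟨x, _, rfl⟩, rfl⟩
      exact symm_coPoint_mem_ptD hX e x
    · rw [sInf_image, ← e.symm.map_sInf, sInf_coPoint, e.symm_apply_apply]
  · intro h
    let _ := covTopology L
    let f : L ↪o Opens (ptD (univ : Set L)) :=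
      OrderEmbedding.ofMapLEIff (fun a => ⟨covOpen a, a, rfl⟩) fun _ _ => covOpen_subset_iff h
    refine ⟨ptD (univ : Set L), covTopology L, isTDSpace_covTopology L,
      ⟨RelIso.ofSurjective f fun V => ?_⟩⟩
    obtain ⟨a, ha⟩ := V.isOpen
    exact ⟨a, Opens.ext ha⟩

end TD
end

section
/- A frame L is spatial (every element of L is a meet of primes) if and only if every smooth sublocale of L is a spatial frame, i.e. S_b(L) ⊆ sp[S(L)]. -/
open Set

universe u

namespace TD

variable {L : Type u} [Order.Frame L]

theorem isComplementedSublocale_univ : IsComplementedSublocale (univ : Set L) := by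
  refine ⟨⟨fun _ _ => mem_univ _, fun _ _ _ => mem_univ _⟩, {⊤}, ⟨fun A hA => ?_, ?_⟩, ?_, ?_⟩
  · exact sInf_eq_top.2 fun a ha => hA ha
  · rintro a s rfl
    exact himp_top
  · exact univ_inter _
  · exact eq_univ_of_forall fun x =>
      ⟨{x}, fun y _ => ⟨univ, mem_insert _ _, mem_univ y⟩, sInf_singleton⟩

theorem isSmooth_univ : IsSmooth (univ : Set L) := by
  refine ⟨{univ}, ?_, ?_⟩
  · rintro C rfl
    exact isComplementedSublocale_univ
  · symm
    exact eq_univ_of_forall fun x => ⟨{x}, fun y _ => ⟨univ, rfl, mem_univ y⟩, sInf_singleton⟩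

theorem mem_pt_of_subset {S T : Set L} (h : S ⊆ T) {p : L} (hp : p ∈ pt T) (hpS : p ∈ S) :
    p ∈ pt S :=
  ⟨hpS, hp.2.1, fun x hx y hy => hp.2.2 x (h hx) y (h hy)⟩

/-- A set contained in a union of two sets has as its meet the meet of the two partial meets. -/
theorem sInf_eq_inf_sInf_inter {A S T : Set L} (hA : A ⊆ S ∪ T) :
    sInf A = sInf (A ∩ S) ⊓ sInf (A ∩ T) := by
  rw [← sInf_union, ← inter_union_distrib_left, inter_eq_left.2 hA]

/-- A prime belongs to one of any two complementary sublocales. -/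
theorem mem_or_mem_of_mem_pt {C C' : Set L} (hC : IsSublocale C) (hC' : IsSublocale C')
    (hjoin : join2 C C' = univ) {p : L} (hp : p ∈ pt (univ : Set L)) : p ∈ C ∨ p ∈ C' := by
  obtain ⟨A, hA, rfl⟩ : p ∈ join2 C C' := hjoin ▸ mem_univ p
  rw [sUnion_pair] at hA
  rcases hp.2.2 _ (mem_univ _) _ (mem_univ _) (sInf_eq_inf_sInf_inter hA) with h | h
  · exact .inl (h ▸ hC.1 _ inter_subset_right)
  · exact .inr (h ▸ hC'.1 _ inter_subset_right)

/-- In a spatial frame, the elements of a complemented sublocale are meets of primes of the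
frame lying in that sublocale. -/
theorem IsComplementedSublocale.exists_sInf_eq {C : Set L} (hC : IsComplementedSublocale C)
    (hL : IsSpatialSub (univ : Set L)) {c : L} (hc : c ∈ C) :
    ∃ P : Set L, P ⊆ pt (univ : Set L) ∩ C ∧ sInf P = c := by
  obtain ⟨hCs, C', hC', hinter, hjoin⟩ := hC
  obtain ⟨P, hP, hPc⟩ := hL c (mem_univ c)
  refine ⟨P ∩ C, inter_subset_inter_left _ hP, ?_⟩
  have hsplit := sInf_eq_inf_sInf_inter
    (show P ⊆ C ∪ C' from fun p hp => mem_or_mem_of_mem_pt hCs hC' hjoin (hP hp))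
  rw [hPc] at hsplit
  set x := sInf (P ∩ C)
  have himp : x ⇨ c = x ⇨ sInf (P ∩ C') := by
    rw [hsplit, himp_inf_distrib, himp_self, top_inf_eq]
  have hmem : x ⇨ c ∈ C ∩ C' :=
    ⟨hCs.2 _ _ hc, himp ▸ hC'.2 _ _ (hC'.1 _ inter_subset_right)⟩
  rw [hinter, mem_singleton_iff, himp_eq_top_iff] at hmem
  exact le_antisymm hmem (hsplit ▸ inf_le_left)

theorem IsSmooth.isSpatialSub {S : Set L} (hS : IsSmooth S)
    (hL : IsSpatialSub (univ : Set L)) : IsSpatialSub S := by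
  obtain ⟨𝒞, h𝒞, rfl⟩ := hS
  rintro _ ⟨A, hA, rfl⟩
  refine ⟨{p | p ∈ pt (sJoin 𝒞) ∧ sInf A ≤ p}, fun p hp => hp.1,
    le_antisymm (le_sInf fun a ha => ?_) (le_sInf fun p hp => hp.2)⟩
  obtain ⟨C, hC, haC⟩ := hA ha
  obtain ⟨P, hP, rfl⟩ := (h𝒞 C hC).exists_sInf_eq hL haC
  exact sInf_le_sInf fun p hp =>
    ⟨mem_pt_of_subset (subset_univ _) (hP hp).1 (subset_sJoin hC (hP hp).2),
      (sInf_le ha).trans (sInf_le hp)⟩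

/-- `L` is spatial iff every smooth sublocale of `L` is a
spatial frame, i.e. `S_b(L) ⊆ sp[S(L)]`. -/
theorem spatial_iff_smooth_spatial (L : Type u) [Order.Frame L] :
    IsSpatialSub (univ : Set L) ↔
      ∀ S : Set L, IsSmooth S → IsSpatialSub S := by
  exact ⟨fun hL _ hS => hS.isSpatialSub hL, fun h => h univ isSmooth_univ⟩

end TD
end

section
/- Let L be a frame, let a ∈ L satisfy a = ⋀ pt(↑a) (a is the meet of the primes above it), and let p ∈ pt(↑a). The following are equivalent: (1) p is an absolutely essential prime of a, i.e. ⋀(pt(↑a) ∖ {p}) ≠ a; (2) whenever a = ⋀P for a set P of primes of L, one has p ∈ P; (3) p is weakly covered (p ≠ ⋀(pt(↑p) ∖ {p})) and p is an essential prime of a (⋀(pt(↑a) ∖ ↑p) ≠ a). -/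
open Set

universe u

namespace TD

variable {L : Type u} [Order.Frame L]

theorem le_or_le_of_mem_pt {p x y : L} (hp : p ∈ pt (univ : Set L)) (h : x ⊓ y ≤ p) :
    x ≤ p ∨ y ≤ p := by
  have e : p = (p ⊔ x) ⊓ (p ⊔ y) := by rw [← sup_inf_left, sup_eq_left.2 h]
  rcases hp.2.2 _ (mem_univ _) _ (mem_univ _) e with h | h
  · exact Or.inl (left_eq_sup.1 h)
  · exact Or.inr (left_eq_sup.1 h)

theorem le_sInf_ptAbove {a : L} {S : Set L} (hS : S ⊆ ptAbove a) : a ≤ sInf S :=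
  le_sInf fun _ hq => (hS hq).2

theorem ptAbove_anti {a b : L} (h : a ≤ b) : ptAbove b ⊆ ptAbove a :=
  fun _ hq => ⟨hq.1, h.trans hq.2⟩

theorem subset_ptAbove {a : L} {P : Set L} (hP : P ⊆ pt (univ : Set L)) (h : sInf P = a) :
    P ⊆ ptAbove a :=
  fun _ hq => ⟨hP hq, h ▸ sInf_le hq⟩

theorem sInf_eq_of_subset_ptAbove_of_le {a : L} (ha : sInf (ptAbove a) = a) {S : Set L}
    (hS : S ⊆ ptAbove a) (h : ∀ q ∈ ptAbove a, q ∉ S → sInf S ≤ q) : sInf S = a := by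
  refine le_antisymm (le_of_le_of_eq (le_sInf fun q hq => ?_) ha) (le_sInf_ptAbove hS)
  by_cases hqS : q ∈ S
  exacts [sInf_le hqS, h q hq hqS]

theorem ptAbove_diff_singleton_eq_union {a p : L} (h : a ≤ p) :
    ptAbove a \ {p} = (ptAbove a \ Ici p) ∪ (ptAbove p \ {p}) := by
  ext q
  constructor
  · rintro ⟨hq, hne⟩
    by_cases hpq : p ≤ q
    exacts [Or.inr ⟨⟨hq.1, hpq⟩, hne⟩, Or.inl ⟨hq, hpq⟩]
  · rintro (⟨hq, hpq⟩ | ⟨hq, hne⟩)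
    exacts [⟨hq, fun e => hpq (mem_singleton_iff.1 e).ge⟩, ⟨ptAbove_anti h hq, hne⟩]

/-- for `a` a meet of the primes above it and `p` a prime above
`a`, TFAE: (1) `p` is an absolutely essential prime of `a`; (2) `p` belongs
to every set of primes whose meet is `a`; (3) `p` is weakly covered and an
essential prime of `a`. -/
theorem absolutely_essential_tfae (a : L) (ha : sInf (ptAbove a) = a)
    (p : L) (hp : p ∈ ptAbove a) :
    [sInf (ptAbove a \ {p}) ≠ a,
     ∀ P : Set L, P ⊆ pt (univ : Set L) → sInf P = a → p ∈ P,
     p ≠ sInf (ptAbove p \ {p}) ∧ sInf (ptAbove a \ Ici p) ≠ a].TFAE := by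
  tfae_have 1 → 2 := by
    intro h P hP hPa
    by_contra hpP
    have hsub : P ⊆ ptAbove a \ {p} :=
      fun q hq => ⟨subset_ptAbove hP hPa hq, fun e => hpP (mem_singleton_iff.1 e ▸ hq)⟩
    exact h (le_antisymm ((sInf_le_sInf hsub).trans_eq hPa) (le_sInf_ptAbove sdiff_subset))
  tfae_have 2 → 1 := fun h e => (h _ (fun _ hq => hq.1.1) e).2 rfl
  tfae_have 1 → 3 := by
    intro h
    have hle : ¬ sInf (ptAbove a \ {p}) ≤ p := fun hle =>
      h <| sInf_eq_of_subset_ptAbove_of_le ha sdiff_subset fun q hq hqS =>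
        hle.trans (not_not.1 fun hpq => hqS ⟨hq, fun e => hpq (mem_singleton_iff.1 e).ge⟩)
    rw [ptAbove_diff_singleton_eq_union hp.2, sInf_union] at hle
    exact ⟨fun e => hle (inf_le_right.trans e.ge),
      fun e => hle (inf_le_left.trans (e.trans_le hp.2))⟩
  tfae_have 3 → 1 := by
    rintro ⟨hw, he⟩ e
    rw [ptAbove_diff_singleton_eq_union hp.2, sInf_union] at e
    rcases le_or_le_of_mem_pt hp.1 (e.trans_le hp.2) with h | h
    · exact he <| sInf_eq_of_subset_ptAbove_of_le ha sdiff_subset fun q hq hqS =>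
        h.trans (not_not.1 fun hpq => hqS ⟨hq, hpq⟩)
    · exact hw (le_antisymm (le_sInf_ptAbove sdiff_subset) h)
  tfae_finish

end TD
end

section
/- Let L be a frame and a ∈ L an element with a = ⋀ pt(↑a) (a is the meet of the primes above it). Then a prime p ∈ pt(↑a) is an essential prime of a (i.e. ⋀(pt(↑a) ∖ ↑p) ≠ a) if and only if p belongs to the Boolean sublocale b(a) = {x → a : x ∈ L}. -/
open Set

universe u

namespace TD

variable {L : Type u} [Order.Frame L]

theorem le_or_le_of_inf_le {p : L} (hp : p ∈ pt (univ : Set L)) {x y : L}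
    (h : x ⊓ y ≤ p) : x ≤ p ∨ y ≤ p := by
  have hsup : p = (p ⊔ x) ⊓ (p ⊔ y) := by rw [← sup_inf_left, sup_eq_left.mpr h]
  rcases hp.2.2 _ (mem_univ _) _ (mem_univ _) hsup with hx | hy
  · exact Or.inl (left_eq_sup.mp hx)
  · exact Or.inr (left_eq_sup.mp hy)

theorem inf_sInf_diff_Ici_le_sInf (S : Set L) (p : L) :
    p ⊓ sInf (S \ Ici p) ≤ sInf S := by
  refine le_sInf fun q hq => ?_
  by_cases hpq : p ≤ q
  · exact inf_le_left.trans hpq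
  · exact inf_le_right.trans (sInf_le ⟨hq, hpq⟩)

/-- for `a` a meet of the primes above it, a prime `p` above
`a` is an essential prime of `a` iff `p ∈ b(a) = {x ⇨ a | x ∈ L}`. -/
theorem essential_iff_mem_bSub (a : L) (ha : sInf (ptAbove a) = a)
    (p : L) (hp : p ∈ ptAbove a) :
    sInf (ptAbove a \ Ici p) ≠ a ↔ p ∈ bSub a := by
  have hinf : p ⊓ sInf (ptAbove a \ Ici p) ≤ a :=
    (inf_sInf_diff_Ici_le_sInf _ p).trans_eq ha
  have hle : a ≤ sInf (ptAbove a \ Ici p) := le_sInf fun q hq => hq.1.2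
  constructor
  · intro hne
    refine ⟨sInf (ptAbove a \ Ici p), le_antisymm (le_himp_iff.mpr hinf) ?_⟩
    rcases le_or_le_of_inf_le hp.1 (inf_himp_le.trans hp.2) with hbp | hbp
    · exact absurd (le_antisymm ((le_inf hbp le_rfl).trans hinf) hle) hne
    · exact hbp
  · rintro ⟨y, hy⟩ heq
    have hya : y ≤ a := by
      rw [← heq]
      refine le_sInf fun q hq => ?_
      have hpy : p ⊓ y ≤ q := (le_himp_iff.mp hy.le).trans hq.1.2
      exact (le_or_le_of_inf_le hq.1.1 hpy).resolve_left hq.2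
    exact hp.1.2.1 (hy.trans (himp_eq_top_iff.mpr hya))

end TD
end

section
/- A frame L is totally spatial (every sublocale of L is a spatial frame) if and only if every D-sublocale of L is spatial, i.e. S_D(L) ⊆ sp[S(L)]. -/
open Set

universe u

namespace TD

variable {L : Type u} [Order.Frame L]

theorem isSublocale_bSub (b : L) : IsSublocale (bSub b) := by
  refine ⟨fun A hA => ⟨sSup {y | y ⇨ b ∈ A}, ?_⟩, ?_⟩
  · refine eq_of_forall_le_iff fun c => ?_
    simp only [le_sInf_iff, le_himp_comm (a := c), sSup_le_iff, mem_ofPred_eq]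
    constructor
    · intro h y hy
      exact le_himp_comm.1 (h _ hy)
    · intro h x hx
      obtain ⟨y, rfl⟩ := hA hx
      exact le_himp_comm.1 (h y hx)
  · rintro a _ ⟨y, rfl⟩
    exact ⟨a ⊓ y, himp_himp _ _ _⟩

theorem bSub_subset {S : Set L} (hS : IsSublocale S) {b : L} (hb : b ∈ S) : bSub b ⊆ S := by
  rintro _ ⟨y, rfl⟩
  exact hS.2 y b hb

theorem ptD_subset_pt {S : Set L} : ptD S ⊆ pt S := by
  rintro p ⟨hp, hp_top, h⟩
  refine ⟨hp, hp_top, fun x hx y hy hxy => ?_⟩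
  simpa using h {x, y} (pair_subset hx hy) (by rw [sInf_pair, hxy])

/-- Primes of a sublocale are primes of any subset containing it. -/
theorem pt_subset_pt {R S : Set L} (hR : IsSublocale R) (hRS : R ⊆ S) : pt R ⊆ pt S := by
  rintro p ⟨hp, hp_top, h⟩
  refine ⟨hRS hp, hp_top, fun x _ y _ hxy => ?_⟩
  have hxp : x ≤ (x ⇨ p) ⇨ p := le_himp_himp
  have hyp : y ≤ x ⇨ p := le_himp_iff'.2 hxy.ge
  have hinf : p = ((x ⇨ p) ⇨ p) ⊓ (x ⇨ p) :=
    le_antisymm (le_inf le_himp le_himp) himp_inf_le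
  rcases h _ (hR.2 _ _ hp) _ (hR.2 _ _ hp) hinf with h | h
  · exact .inl (le_antisymm (hxy.le.trans inf_le_left) (hxp.trans h.ge))
  · exact .inr (le_antisymm (hxy.le.trans inf_le_right) (hyp.trans h.ge))

/-- If `c` lies below every prime of `S` above `a`, then the Boolean sublocale of `c ⇨ a`
has no primes. -/
theorem pt_bSub_himp_eq_empty {S : Set L} (hS : IsSublocale S) {a c : L} (ha : a ∈ S)
    (hc : ∀ p ∈ pt S, a ≤ p → c ≤ p) : pt (bSub (c ⇨ a)) = ∅ := by
  refine eq_empty_of_forall_notMem fun p hp => ?_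
  have hpS : p ∈ pt S :=
    pt_subset_pt (isSublocale_bSub _) (bSub_subset hS (hS.2 c a ha)) hp
  obtain ⟨⟨y, rfl⟩, hp_top, -⟩ := hp
  have hcp : c ≤ y ⇨ c ⇨ a := hc _ hpS (le_himp.trans le_himp)
  apply hp_top
  rw [himp_eq_top_iff, le_himp_iff]
  rw [le_himp_iff, le_himp_iff] at hcp
  exact (le_inf (le_inf inf_le_right inf_le_left) inf_le_right).trans hcp

/-- `L` is totally spatial iff every D-sublocale of `L` is
spatial, i.e. `S_D(L) ⊆ sp[S(L)]`. -/
theorem totally_spatial_iff_DSublocales_spatial (L : Type u) [Order.Frame L] :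
    (∀ S : Set L, IsSublocale S → IsSpatialSub S) ↔
      ∀ S : Set L, IsDSublocale S → IsSpatialSub S := by
  refine ⟨fun h S hS => h S hS.1, fun h S hS a ha => ⟨{p ∈ pt S | a ≤ p}, sep_subset _ _, ?_⟩⟩
  set c := sInf {p ∈ pt S | a ≤ p}
  have hempty : pt (bSub (c ⇨ a)) = ∅ :=
    pt_bSub_himp_eq_empty hS ha fun p hp hap => sInf_le ⟨hp, hap⟩
  have hD : IsDSublocale (bSub (c ⇨ a)) :=
    ⟨isSublocale_bSub _, fun p hp => (hempty.subset (ptD_subset_pt hp)).elim⟩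
  obtain ⟨P, hP, hPa⟩ := h _ hD (c ⇨ a) ⟨⊤, top_himp.symm⟩
  rw [hempty, subset_empty_iff] at hP
  rw [hP, sInf_empty, eq_comm, himp_eq_top_iff] at hPa
  exact le_antisymm hPa (le_sInf fun p hp => hp.2)

end TD
end
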